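/- arXiv:1711.03853 — 3 statements merged into one kernel-verified Lean document; each statement's English description precedes it below -/
import Mathlib

section
/- Parameter-wise characterization of viscosity solutions: Let H∈C(ℝⁿ) and consider the equation u_t + H(∇_x u) = 0 for u = u(t,x,y), (t,x,y) ∈ (0,∞)×ℝⁿ×ℝᵐ, with initial condition u(0,x,y) = u₀(x,y) ∈ BUC(ℝⁿ×ℝᵐ). A function u ∈ BUC_loc([0,∞)×ℝⁿ×ℝᵐ) is a viscosity solution of this problem if and only if for every fixed y ∈ ℝᵐ the function u^y(t,x) = u(t,x,y) is a viscosity solution of u_t + H(∇_x u) = 0 on (0,∞)×ℝⁿ with initial data u₀^y(x) = u₀(x,y). -/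
open Set Filter Topology RealInnerProductSpace MeasureTheory

noncomputable section

variable {E : Type*} [NormedAddCommGroup E] [InnerProductSpace ℝ E]

/-- The open half-space `Π = (0,∞) × ℝⁿ`. -/
def PiDom (E : Type*) [NormedAddCommGroup E] [InnerProductSpace ℝ E] : Set (ℝ × E) :=
  Set.Ioi (0:ℝ) ×ˢ (Set.univ : Set E)

/-- Bounded uniformly continuous functions on `ℝⁿ`. -/
def IsBUC (u₀ : E → ℝ) : Prop :=
  UniformContinuous u₀ ∧ ∃ M : ℝ, ∀ x, |u₀ x| ≤ M

/-- `BUC_loc(Π̄)` : continuous on `Π̄ = [0,∞)×ℝⁿ`, bounded and uniformly continuous on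
each layer `[0,T)×ℝⁿ`, `T>0`. -/
def IsBUCloc (u : ℝ × E → ℝ) : Prop :=
  ContinuousOn u (Set.Ici (0:ℝ) ×ˢ (Set.univ : Set E)) ∧
  ∀ T : ℝ, 0 < T →
    (∃ M : ℝ, ∀ p ∈ Set.Ico (0:ℝ) T ×ˢ (Set.univ : Set E), |u p| ≤ M) ∧
    UniformContinuousOn u (Set.Ico (0:ℝ) T ×ˢ (Set.univ : Set E))

/-- The superdifferential `D⁺u(t₀,x₀)`: pairs `(s,v) = ∇φ(t₀,x₀)` over all `C¹` functions `φ`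
such that `(t₀,x₀)` is a point of local maximum of `u - φ` in `Π`. -/
def superdiff (u : ℝ × E → ℝ) (p : ℝ × E) : Set (ℝ × E) :=
  {sv | ∃ φ : ℝ × E → ℝ, ContDiff ℝ 1 φ ∧
    IsLocalMaxOn (fun q => u q - φ q) (PiDom E) p ∧
    fderiv ℝ φ p (1, 0) = sv.1 ∧ ∀ w : E, fderiv ℝ φ p (0, w) = ⟪sv.2, w⟫}

/-- The subdifferential `D⁻u(t₀,x₀)`. -/
def subdiff (u : ℝ × E → ℝ) (p : ℝ × E) : Set (ℝ × E) :=
  {sv | ∃ φ : ℝ × E → ℝ, ContDiff ℝ 1 φ ∧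
    IsLocalMinOn (fun q => u q - φ q) (PiDom E) p ∧
    fderiv ℝ φ p (1, 0) = sv.1 ∧ ∀ w : E, fderiv ℝ φ p (0, w) = ⟪sv.2, w⟫}

/-- Viscosity subsolution of `u_t + H(∇ₓu) = 0`, `u(0,·) = u₀`. -/
def IsViscSubsol (H : E → ℝ) (u₀ : E → ℝ) (u : ℝ × E → ℝ) : Prop :=
  IsBUCloc u ∧ (∀ x, u (0, x) ≤ u₀ x) ∧
  ∀ p ∈ PiDom E, ∀ sv ∈ superdiff u p, sv.1 + H sv.2 ≤ 0

/-- Viscosity supersolution of `u_t + H(∇ₓu) = 0`, `u(0,·) = u₀`. -/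
def IsViscSupersol (H : E → ℝ) (u₀ : E → ℝ) (u : ℝ × E → ℝ) : Prop :=
  IsBUCloc u ∧ (∀ x, u₀ x ≤ u (0, x)) ∧
  ∀ p ∈ PiDom E, ∀ sv ∈ subdiff u p, 0 ≤ sv.1 + H sv.2

/-- Viscosity solution of `u_t + H(∇ₓu) = 0`, `u(0,·) = u₀`. -/
def IsViscSol (H : E → ℝ) (u₀ : E → ℝ) (u : ℝ × E → ℝ) : Prop :=
  IsViscSubsol H u₀ u ∧ IsViscSupersol H u₀ u

variable {Y : Type*} [NormedAddCommGroup Y] [InnerProductSpace ℝ Y]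

/-- The open half-space `(0,∞) × ℝⁿ × ℝᵐ`. -/
def PiDom2 (E Y : Type*) [NormedAddCommGroup E] [InnerProductSpace ℝ E]
    [NormedAddCommGroup Y] [InnerProductSpace ℝ Y] : Set (ℝ × E × Y) :=
  Set.Ioi (0:ℝ) ×ˢ (Set.univ : Set (E × Y))

/-- Bounded uniformly continuous functions on `ℝⁿ × ℝᵐ`. -/
def IsBUC2 (u₀ : E × Y → ℝ) : Prop :=
  UniformContinuous u₀ ∧ ∃ M : ℝ, ∀ z, |u₀ z| ≤ M

/-- `BUC_loc` on `[0,∞) × ℝⁿ × ℝᵐ`. -/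
def IsBUCloc2 (U : ℝ × E × Y → ℝ) : Prop :=
  ContinuousOn U (Set.Ici (0:ℝ) ×ˢ (Set.univ : Set (E × Y))) ∧
  ∀ T : ℝ, 0 < T →
    (∃ M : ℝ, ∀ P ∈ Set.Ico (0:ℝ) T ×ˢ (Set.univ : Set (E × Y)), |U P| ≤ M) ∧
    UniformContinuousOn U (Set.Ico (0:ℝ) T ×ˢ (Set.univ : Set (E × Y)))

/-- Superdifferential `D⁺U(t₀,x₀,y₀)`, with the spatial gradient split into its
`x`- and `y`-components. -/
def superdiff2 (U : ℝ × E × Y → ℝ) (P : ℝ × E × Y) : Set (ℝ × E × Y) :=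
  {svw | ∃ φ : ℝ × E × Y → ℝ, ContDiff ℝ 1 φ ∧
    IsLocalMaxOn (fun q => U q - φ q) (PiDom2 E Y) P ∧
    fderiv ℝ φ P (1, 0, 0) = svw.1 ∧
    (∀ a : E, fderiv ℝ φ P (0, a, 0) = ⟪svw.2.1, a⟫) ∧
    (∀ b : Y, fderiv ℝ φ P (0, 0, b) = ⟪svw.2.2, b⟫)}

/-- Subdifferential `D⁻U(t₀,x₀,y₀)`. -/
def subdiff2 (U : ℝ × E × Y → ℝ) (P : ℝ × E × Y) : Set (ℝ × E × Y) :=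
  {svw | ∃ φ : ℝ × E × Y → ℝ, ContDiff ℝ 1 φ ∧
    IsLocalMinOn (fun q => U q - φ q) (PiDom2 E Y) P ∧
    fderiv ℝ φ P (1, 0, 0) = svw.1 ∧
    (∀ a : E, fderiv ℝ φ P (0, a, 0) = ⟪svw.2.1, a⟫) ∧
    (∀ b : Y, fderiv ℝ φ P (0, 0, b) = ⟪svw.2.2, b⟫)}

/-- Viscosity subsolution of `u_t + H(∇ₓu) = 0`, `u(0,x,y) = u₀(x,y)`, in the extended domain
`(0,∞) × ℝⁿ × ℝᵐ` (the hamiltonian sees only the `x`-component of the gradient). -/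
def IsViscSubsol2 (H : E → ℝ) (u₀ : E × Y → ℝ) (U : ℝ × E × Y → ℝ) : Prop :=
  IsBUCloc2 U ∧ (∀ z : E × Y, U (0, z) ≤ u₀ z) ∧
  ∀ P ∈ PiDom2 E Y, ∀ svw ∈ superdiff2 U P, svw.1 + H svw.2.1 ≤ 0

/-- Viscosity supersolution in the extended domain. -/
def IsViscSupersol2 (H : E → ℝ) (u₀ : E × Y → ℝ) (U : ℝ × E × Y → ℝ) : Prop :=
  IsBUCloc2 U ∧ (∀ z : E × Y, u₀ z ≤ U (0, z)) ∧
  ∀ P ∈ PiDom2 E Y, ∀ svw ∈ subdiff2 U P, 0 ≤ svw.1 + H svw.2.1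

/-- Viscosity solution in the extended domain. -/
def IsViscSol2 (H : E → ℝ) (u₀ : E × Y → ℝ) (U : ℝ × E × Y → ℝ) : Prop :=
  IsViscSubsol2 H u₀ U ∧ IsViscSupersol2 H u₀ U

theorem neg_mem_superdiff_neg {u : ℝ × E → ℝ} {p : ℝ × E} {sv : ℝ × E}
    (h : sv ∈ subdiff u p) : -sv ∈ superdiff (fun q => -u q) p := by
  obtain ⟨φ, hφ, hmin, hs, hv⟩ := h
  refine ⟨fun q => -φ q, hφ.neg, ?_, ?_, fun w => ?_⟩
  · refine Eventually.mono hmin fun q hq => ?_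
    dsimp only at hq ⊢
    linarith
  · simp [fderiv_fun_neg, hs]
  · simp [fderiv_fun_neg, hv]

theorem neg_mem_subdiff2_of_mem_superdiff2_neg {U : ℝ × E × Y → ℝ} {P : ℝ × E × Y}
    {svw : ℝ × E × Y} (h : svw ∈ superdiff2 (fun q => -U q) P) : -svw ∈ subdiff2 U P := by
  obtain ⟨φ, hφ, hmax, hs, hv, hw⟩ := h
  refine ⟨fun q => -φ q, hφ.neg, ?_, ?_, fun a => ?_, fun b => ?_⟩
  · refine Eventually.mono hmax fun q hq => ?_
    dsimp only at hq ⊢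
    linarith
  · simp [fderiv_fun_neg, hs]
  · simp [fderiv_fun_neg, hv]
  · simp [fderiv_fun_neg, hw]

theorem tendsto_slice_nhdsWithin (p : ℝ × E) (y : Y) :
    Tendsto (fun q : ℝ × E => (q.1, q.2, y)) (𝓝[PiDom E] p)
      (𝓝[PiDom2 E Y] (p.1, p.2, y)) := by
  refine tendsto_nhdsWithin_iff.2 ⟨?_, ?_⟩
  · have : Continuous fun q : ℝ × E => (q.1, q.2, y) := by fun_prop
    exact this.continuousAt.tendsto.mono_left nhdsWithin_le_nhds
  · filter_upwards [self_mem_nhdsWithin] with q hq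
    exact ⟨hq.1, mem_univ _⟩

theorem fderiv_comp_slice {φ : ℝ × E × Y → ℝ} (hφ : ContDiff ℝ 1 φ) (p : ℝ × E) (y : Y)
    (a : ℝ × E) :
    fderiv ℝ (fun q : ℝ × E => φ (q.1, q.2, y)) p a
      = fderiv ℝ φ (p.1, p.2, y) (a.1, a.2, 0) := by
  have hι : HasFDerivAt (fun q : ℝ × E => (q.1, q.2, y))
      ((ContinuousLinearMap.fst ℝ ℝ E).prod ((ContinuousLinearMap.snd ℝ ℝ E).prod 0)) p :=
    hasFDerivAt_fst.prodMk (hasFDerivAt_snd.prodMk (hasFDerivAt_const y p))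
  have hd : HasFDerivAt φ (fderiv ℝ φ (p.1, p.2, y)) (p.1, p.2, y) :=
    (hφ.differentiable one_ne_zero _).hasFDerivAt
  have := (hd.comp p hι).fderiv
  rw [show (fun q : ℝ × E => φ (q.1, q.2, y)) = φ ∘ fun q : ℝ × E => (q.1, q.2, y) from rfl,
    this]
  rfl

theorem slice_mem_superdiff {U : ℝ × E × Y → ℝ} {P svw : ℝ × E × Y}
    (h : svw ∈ superdiff2 U P) :
    (svw.1, svw.2.1) ∈ superdiff (fun q : ℝ × E => U (q.1, q.2, P.2.2)) (P.1, P.2.1) := by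
  obtain ⟨φ, hφ, hmax, hs, hv, -⟩ := h
  refine ⟨fun q => φ (q.1, q.2, P.2.2), hφ.comp (by fun_prop),
    (tendsto_slice_nhdsWithin (P.1, P.2.1) P.2.2).eventually hmax, ?_, fun a => ?_⟩
  · rw [fderiv_comp_slice hφ]; exact hs
  · rw [fderiv_comp_slice hφ]; exact hv a

theorem slice_mem_subdiff {U : ℝ × E × Y → ℝ} {P svw : ℝ × E × Y}
    (h : svw ∈ subdiff2 U P) :
    (svw.1, svw.2.1) ∈ subdiff (fun q : ℝ × E => U (q.1, q.2, P.2.2)) (P.1, P.2.1) := by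
  obtain ⟨φ, hφ, hmin, hs, hv, -⟩ := h
  refine ⟨fun q => φ (q.1, q.2, P.2.2), hφ.comp (by fun_prop),
    (tendsto_slice_nhdsWithin (P.1, P.2.1) P.2.2).eventually hmin, ?_, fun a => ?_⟩
  · rw [fderiv_comp_slice hφ]; exact hs
  · rw [fderiv_comp_slice hφ]; exact hv a

theorem IsBUCloc2.slice {E Y : Type*} [NormedAddCommGroup E] [NormedAddCommGroup Y]
    {U : ℝ × E × Y → ℝ} (hU : IsBUCloc2 U) (y : Y) :
    IsBUCloc (fun p : ℝ × E => U (p.1, p.2, y)) := by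
  have hι : UniformContinuous fun p : ℝ × E => (p.1, p.2, y) :=
    uniformContinuous_fst.prodMk (uniformContinuous_snd.prodMk uniformContinuous_const)
  refine ⟨hU.1.comp hι.continuous.continuousOn fun p hp => ⟨hp.1, mem_univ _⟩,
    fun T hT => ⟨?_, ?_⟩⟩
  · obtain ⟨M, hM⟩ := (hU.2 T hT).1
    exact ⟨M, fun p hp => hM _ ⟨hp.1, mem_univ _⟩⟩
  · exact (hU.2 T hT).2.comp hι.uniformContinuousOn fun p hp => ⟨hp.1, mem_univ _⟩

/-- A large multiple of a penalty `h` that vanishes only where `g` is below `c` pushes `g` below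
`c` on a whole compact set. -/
theorem IsCompact.exists_sub_mul_lt {X : Type*} [TopologicalSpace X] {K : Set X}
    (hK : IsCompact K) {g h : X → ℝ} (hg : ContinuousOn g K) (hh : ContinuousOn h K)
    (h_nonneg : ∀ x ∈ K, 0 ≤ h x) {c : ℝ} (hlt : ∀ x ∈ K, h x = 0 → g x < c) :
    ∃ k : ℝ, ∀ x ∈ K, g x - k * h x < c := by
  suffices ∃ k : ℝ, ∀ x ∈ K, ∀ k' ≥ k, x ∈ K → g x - k' * h x < c by
    obtain ⟨k, hk⟩ := this
    exact ⟨k, fun x hx => hk x hx k le_rfl hx⟩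
  refine hK.induction_on (p := fun s => ∃ k : ℝ, ∀ x ∈ s, ∀ k' ≥ k, x ∈ K → g x - k' * h x < c)
    ⟨0, by simp⟩ ?_ ?_ ?_
  · rintro s t hst ⟨k, hk⟩
    exact ⟨k, fun x hx => hk x (hst hx)⟩
  · rintro s t ⟨k, hk⟩ ⟨l, hl⟩
    refine ⟨max k l, ?_⟩
    rintro x (hx | hx) k' hk'
    · exact hk x hx k' ((le_max_left _ _).trans hk')
    · exact hl x hx k' ((le_max_right _ _).trans hk')
  · intro x hx
    obtain ⟨k, hk⟩ : ∃ k : ℝ, g x - k * h x < c := by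
      by_cases h0 : h x = 0
      · exact ⟨0, by simpa using hlt x hx h0⟩
      · refine ⟨(g x - c) / h x + 1, ?_⟩
        have : 0 < h x := lt_of_le_of_ne (h_nonneg x hx) (Ne.symm h0)
        rw [add_mul, div_mul_cancel₀ _ h0]
        linarith
    have hcont : ContinuousWithinAt (fun z => g z - k * h z) K x :=
      (hg x hx).sub (continuousWithinAt_const.mul (hh x hx))
    refine ⟨_, hcont.eventually_lt_const hk, k, fun z hz k' hk' hzK => ?_⟩
    have hz' : g z - k * h z < c := hz
    have := mul_le_mul_of_nonneg_right hk' (h_nonneg z hzK)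
    linarith

/-- The test function `φ` on `ℝ × E` with a quadratic penalty centred at `P₀`, of weight `k` in the
direction of `Y`. -/
def penalized (φ : ℝ × E → ℝ) (P₀ : ℝ × E × Y) (k : ℝ) (q : ℝ × E × Y) : ℝ :=
  φ (q.1, q.2.1) + (‖q.1 - P₀.1‖ ^ 2 + ‖q.2.1 - P₀.2.1‖ ^ 2) + k * ‖q.2.2 - P₀.2.2‖ ^ 2

theorem contDiff_penalized {φ : ℝ × E → ℝ} (hφ : ContDiff ℝ 1 φ) (P₀ : ℝ × E × Y) (k : ℝ) :
    ContDiff ℝ 1 (penalized φ P₀ k) := by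
  unfold penalized
  have h1 : ContDiff ℝ 1 fun q : ℝ × E × Y => φ (q.1, q.2.1) := hφ.comp (by fun_prop)
  have h2 : ContDiff ℝ 1 fun q : ℝ × E × Y => ‖q.1 - P₀.1‖ ^ 2 :=
    ContDiff.norm_sq ℝ (by fun_prop)
  have h3 : ContDiff ℝ 1 fun q : ℝ × E × Y => ‖q.2.1 - P₀.2.1‖ ^ 2 :=
    ContDiff.norm_sq ℝ (by fun_prop)
  have h4 : ContDiff ℝ 1 fun q : ℝ × E × Y => ‖q.2.2 - P₀.2.2‖ ^ 2 :=
    ContDiff.norm_sq ℝ (by fun_prop)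
  exact (h1.add (h2.add h3)).add (contDiff_const.mul h4)

theorem fderiv_penalized {φ : ℝ × E → ℝ} (hφ : ContDiff ℝ 1 φ) (P₀ : ℝ × E × Y) (k : ℝ)
    (P d : ℝ × E × Y) :
    fderiv ℝ (penalized φ P₀ k) P d = fderiv ℝ φ (P.1, P.2.1) (d.1, d.2.1)
      + (2 * ⟪P.1 - P₀.1, d.1⟫ + 2 * ⟪P.2.1 - P₀.2.1, d.2.1⟫)
      + k * (2 * ⟪P.2.2 - P₀.2.2, d.2.2⟫) := by
  have ht : HasFDerivAt (fun q : ℝ × E × Y => q.1) (ContinuousLinearMap.fst ℝ ℝ (E × Y)) P :=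
    hasFDerivAt_fst
  have hz : HasFDerivAt (fun q : ℝ × E × Y => q.2) (ContinuousLinearMap.snd ℝ ℝ (E × Y)) P :=
    hasFDerivAt_snd
  have hd : HasFDerivAt φ (fderiv ℝ φ (P.1, P.2.1)) (P.1, P.2.1) :=
    (hφ.differentiable one_ne_zero _).hasFDerivAt
  have h1 := hd.comp P (ht.prodMk hz.fst)
  have h := (h1.add (((ht.sub_const P₀.1).norm_sq).add ((hz.fst.sub_const P₀.2.1).norm_sq))).add
    (((hz.snd.sub_const P₀.2.2).norm_sq).const_mul k)
  have h' : HasFDerivAt (penalized φ P₀ k) _ P := h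
  rw [h'.fderiv]
  simp [inner_sub_left]
  ring

/-- Superdifferentials of slices are limits of `(t, x)`-components of superdifferentials. -/
theorem exists_superdiff2_near [FiniteDimensional ℝ E] [FiniteDimensional ℝ Y]
    {U : ℝ × E × Y → ℝ} (hU : ContinuousOn U (PiDom2 E Y)) {p : ℝ × E} (hp : p ∈ PiDom E)
    {y : Y} {sv : ℝ × E} (hsv : sv ∈ superdiff (fun q : ℝ × E => U (q.1, q.2, y)) p)
    {N : Set (ℝ × E)} (hN : N ∈ 𝓝 sv) :
    ∃ P ∈ PiDom2 E Y, ∃ svw ∈ superdiff2 U P, (svw.1, svw.2.1) ∈ N := by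
  obtain ⟨φ, hφ, hmax, hs, hv⟩ := hsv
  set P₀ : ℝ × E × Y := (p.1, p.2, y) with hP₀
  let s : ℝ × E × Y → ℝ := fun P => fderiv ℝ φ (P.1, P.2.1) (1, 0) + 2 * (P.1 - P₀.1)
  let v : ℝ × E × Y → E := fun P => (InnerProductSpace.toDual ℝ E).symm
    ((fderiv ℝ φ (P.1, P.2.1)).comp (ContinuousLinearMap.inr ℝ ℝ E)) + (2 : ℝ) • (P.2.1 - P₀.2.1)
  have hdφ : Continuous fun P : ℝ × E × Y => fderiv ℝ φ (P.1, P.2.1) :=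
    (hφ.continuous_fderiv one_ne_zero).comp (by fun_prop)
  have hcont : Continuous fun P => (s P, v P) := by
    refine Continuous.prodMk ?_ ?_
    · exact (hdφ.clm_apply continuous_const).add (by fun_prop)
    · exact ((InnerProductSpace.toDual ℝ E).symm.continuous.comp
        (hdφ.clm_comp continuous_const)).add (by fun_prop)
  have hsv₀ : (s P₀, v P₀) = sv := by
    refine Prod.ext (by simp [s, P₀, hs]) (ext_inner_right ℝ fun w => ?_)
    simp [v, P₀, hv]
  have hopen : IsOpen (PiDom2 E Y) := isOpen_Ioi.prod isOpen_univ
  have hopen' : IsOpen (PiDom E) := isOpen_Ioi.prod isOpen_univ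
  have hP₀mem : P₀ ∈ PiDom2 E Y := ⟨hp.1, mem_univ _⟩
  have hmax' : ∀ᶠ q : ℝ × E in 𝓝 p, U (q.1, q.2, y) - φ q ≤ U P₀ - φ p := by
    have := hmax
    rw [IsLocalMaxOn, hopen'.nhdsWithin_eq hp] at this
    exact this
  have hpr : Continuous fun P : ℝ × E × Y => (P.1, P.2.1) := by fun_prop
  have hnear : ∀ᶠ P in 𝓝 P₀, P ∈ PiDom2 E Y ∧ (s P, v P) ∈ N ∧
      U (P.1, P.2.1, y) - φ (P.1, P.2.1) ≤ U P₀ - φ p := by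
    refine (hopen.eventually_mem hP₀mem).and (Eventually.and ?_ ?_)
    · exact hcont.continuousAt.tendsto.eventually_mem (by rwa [hsv₀])
    · exact (hpr.continuousAt (x := P₀)).tendsto.eventually hmax'
  obtain ⟨r, hr, hball⟩ := Metric.nhds_basis_closedBall.eventually_iff.1 hnear
  set K := Metric.closedBall P₀ r
  have hK : IsCompact K := isCompact_closedBall _ _
  have hUK : ContinuousOn U K := hU.mono fun P hP => (hball hP).1
  let g : ℝ × E × Y → ℝ := fun P => U P - penalized φ P₀ 0 P
  let h : ℝ × E × Y → ℝ := fun P => ‖P.2.2 - y‖ ^ 2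
  have hg : ContinuousOn g K := hUK.sub (contDiff_penalized hφ P₀ 0).continuous.continuousOn
  have hh : Continuous h := by fun_prop
  have hgh : ∀ k P, U P - penalized φ P₀ k P = g P - k * h P := by
    intro k P
    simp only [g, h, penalized, hP₀]
    ring
  have hg₀ : g P₀ = U P₀ - φ p := by simp [g, penalized, P₀]
  have hh₀ : h P₀ = 0 := by simp [h, P₀]
  obtain ⟨k, hk⟩ := (hK.diff (Metric.isOpen_ball (x := P₀) (ε := r))).exists_sub_mul_lt
    (g := g) (h := h) (c := g P₀) (hg.mono sdiff_subset) hh.continuousOn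
    (fun P _ => by positivity) (by
      rintro P ⟨hPK, hPb⟩ hP0
      have hy : P.2.2 = y := by simpa [h, sub_eq_zero] using hP0
      have hle := (hball hPK).2.2
      have hPeq : (P.1, P.2.1, y) = P := by rw [← hy]
      rw [hPeq] at hle
      have hne : P ≠ P₀ := by
        rintro rfl
        exact hPb (Metric.mem_ball_self hr)
      have hpos : 0 < ‖P.1 - P₀.1‖ ^ 2 + ‖P.2.1 - P₀.2.1‖ ^ 2 := by
        by_contra! hcon
        have h1 : ‖P.1 - P₀.1‖ ^ 2 = 0 := by
          nlinarith [sq_nonneg ‖P.1 - P₀.1‖, sq_nonneg ‖P.2.1 - P₀.2.1‖]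
        have h2 : ‖P.2.1 - P₀.2.1‖ ^ 2 = 0 := by
          nlinarith [sq_nonneg ‖P.1 - P₀.1‖, sq_nonneg ‖P.2.1 - P₀.2.1‖]
        rw [sq_eq_zero_iff, norm_eq_zero, sub_eq_zero] at h1 h2
        exact hne (Prod.ext h1 (Prod.ext h2 hy))
      rw [hg₀]
      simp only [g, penalized]
      linarith)
  obtain ⟨P, hPK, hPmax⟩ := hK.exists_isMaxOn ⟨P₀, Metric.mem_closedBall_self hr.le⟩
    (hg.sub (hh.continuousOn.const_mul k))
  have hPb : P ∈ Metric.ball P₀ r := by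
    by_contra hcon
    have h1 := hk P ⟨hPK, hcon⟩
    have h2 : g P₀ - k * h P₀ ≤ g P - k * h P := hPmax (Metric.mem_closedBall_self hr.le)
    rw [hh₀] at h2
    linarith
  have hKP : K ∈ 𝓝 P := mem_of_superset (Metric.isOpen_ball.mem_nhds hPb)
    Metric.ball_subset_closedBall
  refine ⟨P, (hball hPK).1, (s P, v P, (k * 2) • (P.2.2 - y)),
    ⟨penalized φ P₀ k, contDiff_penalized hφ P₀ k, ?_, ?_, fun a => ?_, fun b => ?_⟩,
    (hball hPK).2.1⟩
  · refine IsLocalMax.on ?_ _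
    simp only [hgh]
    exact hPmax.isLocalMax hKP
  · simp [fderiv_penalized hφ, s]
  · simp [fderiv_penalized hφ, v, inner_add_left, real_inner_smul_left]
  · simp [fderiv_penalized hφ, P₀, real_inner_smul_left, mul_assoc,
      show ((0 : ℝ), (0 : E)) = 0 from rfl]

theorem slice_superdiff_le [FiniteDimensional ℝ E] [FiniteDimensional ℝ Y]
    {F : ℝ × E → ℝ} (hF : Continuous F)
    {U : ℝ × E × Y → ℝ} (hU : ContinuousOn U (PiDom2 E Y))
    (hsub : ∀ P ∈ PiDom2 E Y, ∀ svw ∈ superdiff2 U P, F (svw.1, svw.2.1) ≤ 0)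
    {p : ℝ × E} (hp : p ∈ PiDom E) {y : Y} {sv : ℝ × E}
    (hsv : sv ∈ superdiff (fun q : ℝ × E => U (q.1, q.2, y)) p) : F sv ≤ 0 := by
  by_contra! hpos
  obtain ⟨P, hP, svw, hsvw, hlt⟩ := exists_superdiff2_near hU hp hsv
    (hF.continuousAt.eventually_const_lt hpos)
  exact absurd (hsub P hP svw hsvw) (not_le.2 hlt)

/-- **Parameter-wise characterization** (Lemma 2): `u ∈ BUC_loc` is a viscosity solution of
`u_t + H(∇ₓu) = 0`, `u(0,x,y) = u₀(x,y)`, iff for every fixed `y` the slice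
`uʸ(t,x) = u(t,x,y)` is a viscosity solution with data `u₀ʸ(x) = u₀(x,y)`. -/
theorem parameterwise_characterization {n m : ℕ}
    (H : EuclideanSpace ℝ (Fin n) → ℝ) (hH : Continuous H)
    (u₀ : EuclideanSpace ℝ (Fin n) × EuclideanSpace ℝ (Fin m) → ℝ) (h₀ : IsBUC2 u₀)
    (U : ℝ × EuclideanSpace ℝ (Fin n) × EuclideanSpace ℝ (Fin m) → ℝ)
    (hU : IsBUCloc2 U) :
    IsViscSol2 H u₀ U ↔
      ∀ y : EuclideanSpace ℝ (Fin m),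
        IsViscSol H (fun x => u₀ (x, y))
          (fun p : ℝ × EuclideanSpace ℝ (Fin n) => U (p.1, p.2, y)) := by
  have hcont : ContinuousOn U (PiDom2 (EuclideanSpace ℝ (Fin n)) (EuclideanSpace ℝ (Fin m))) :=
    hU.1.mono (prod_mono Ioi_subset_Ici_self subset_rfl)
  constructor
  · rintro ⟨⟨-, hle, hsub⟩, -, hge, hsup⟩ y
    refine ⟨⟨hU.slice y, fun x => hle (x, y), fun p hp sv hsv => ?_⟩,
      hU.slice y, fun x => hge (x, y), fun p hp sv hsv => ?_⟩
    · exact slice_superdiff_le (F := fun sv => sv.1 + H sv.2) (by fun_prop) hcont hsub hp hsv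
    · have := slice_superdiff_le (F := fun sv => sv.1 - H (-sv.2)) (by fun_prop) hcont.neg
        (fun P hP svw hsvw => by
          have := hsup P hP _ (neg_mem_subdiff2_of_mem_superdiff2_neg hsvw)
          simp only [Prod.fst_neg, Prod.snd_neg] at this
          linarith) hp (neg_mem_superdiff_neg hsv)
      simp only [Prod.fst_neg, Prod.snd_neg, neg_neg] at this
      linarith
  · intro h
    refine ⟨⟨hU, fun z => (h z.2).1.2.1 z.1, fun P hP svw hsvw => ?_⟩,
      hU, fun z => (h z.2).2.2.1 z.1, fun P hP svw hsvw => ?_⟩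
    · exact (h P.2.2).1.2.2 (P.1, P.2.1) ⟨hP.1, mem_univ _⟩ _ (slice_mem_superdiff hsvw)
    · exact (h P.2.2).2.2.2 (P.1, P.2.1) ⟨hP.1, mem_univ _⟩ _ (slice_mem_subdiff hsvw)
end
end

section
/- Pullback of viscosity solutions along an arbitrary linear map: Let H∈C(ℝⁿ), let Λ:ℝⁿ→ℝᵐ be a linear map with adjoint Λ*:ℝᵐ→ℝⁿ, let v₀∈BUC(ℝᵐ), and let v∈BUC_loc([0,∞)×ℝᵐ) be a viscosity solution of v_t + H(Λ*∇_y v) = 0, v(0,y)=v₀(y), on (0,∞)×ℝᵐ. Then the function u(t,x) = v(t,Λx) is a viscosity solution of u_t + H(∇_x u) = 0 on (0,∞)×ℝⁿ with initial data u₀(x) = v₀(Λx). -/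
open Set Filter Topology RealInnerProductSpace MeasureTheory

noncomputable section

variable {E : Type*} [NormedAddCommGroup E] [InnerProductSpace ℝ E]

variable {F : Type*} [NormedAddCommGroup F] [InnerProductSpace ℝ F]

theorem isOpen_PiDom : IsOpen (PiDom E) := isOpen_Ioi.prod isOpen_univ

theorem IsBUCloc.comp_linear {v : ℝ × F → ℝ} (hv : IsBUCloc v) (Λ : E →L[ℝ] F) :
    IsBUCloc (fun p : ℝ × E => v (p.1, Λ p.2)) := by
  have hA : UniformContinuous (fun p : ℝ × E => (p.1, Λ p.2)) :=
    uniformContinuous_fst.prodMk (Λ.uniformContinuous.comp uniformContinuous_snd)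
  refine ⟨hv.1.comp hA.continuous.continuousOn fun p hp => ⟨hp.1, mem_univ _⟩, fun T hT => ?_⟩
  obtain ⟨⟨M, hM⟩, huc⟩ := hv.2 T hT
  exact ⟨⟨M, fun p hp => hM _ ⟨hp.1, mem_univ _⟩⟩,
    huc.comp hA.uniformContinuousOn fun p hp => ⟨hp.1, mem_univ _⟩⟩

theorem mem_superdiff_neg {u : ℝ × E → ℝ} {p sv : ℝ × E} :
    sv ∈ superdiff (fun q => -u q) p ↔ -sv ∈ subdiff u p := by
  constructor
  · rintro ⟨φ, hφ, hmax, ht, hx⟩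
    refine ⟨fun q => -φ q, hφ.neg, ?_, ?_, fun w => ?_⟩
    · simpa only [neg_sub', neg_neg, sub_neg_eq_add] using hmax.neg
    · simp [fderiv_fun_neg, ht]
    · simp [fderiv_fun_neg, hx]
  · rintro ⟨φ, hφ, hmin, ht, hx⟩
    refine ⟨fun q => -φ q, hφ.neg, ?_, ?_, fun w => ?_⟩
    · simpa only [neg_sub', neg_neg, sub_neg_eq_add] using hmin.neg
    · simp [fderiv_fun_neg, ht]
    · simp [fderiv_fun_neg, hx]

/-- A penalisation `k • h` with `k` large localises the maxima of `g - k • h` near a strict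
maximum point of `g` on the zero set of `h`. -/
theorem exists_penalized_max {X : Type*} [TopologicalSpace X] {K U : Set X} (hK : IsCompact K)
    {g h : X → ℝ} (hg : ContinuousOn g K) (hh : Continuous h) (h_nonneg : ∀ z, 0 ≤ h z)
    {z₀ : X} (hz₀ : z₀ ∈ K) (h₀ : h z₀ = 0) (hU : IsOpen U) (hz₀U : z₀ ∈ U)
    (hstrict : ∀ z ∈ K, h z = 0 → z ≠ z₀ → g z < g z₀) :
    ∃ k : ℝ, ∃ z ∈ K ∩ U, IsMaxOn (fun z => g z - k * h z) K z := by
  have key : ∃ k : ℕ, ∀ z ∈ K \ U, g z - k * h z < g z₀ := by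
    by_contra! hcon
    have hS : IsCompact (K \ U) := hK.diff hU
    choose z hz hzg using hcon
    obtain ⟨a, ha, hcl⟩ := hS.exists_mapClusterPt (f := atTop) (u := z)
      (tendsto_principal.mpr (Eventually.of_forall hz))
    have hane : a ≠ z₀ := fun e => ha.2 (e ▸ hz₀U)
    obtain ⟨k, hk⟩ : ∃ k : ℕ, g a - k * h a < g z₀ := by
      rcases (h_nonneg a).eq_or_lt with h0 | hpos
      · exact ⟨0, by simpa using hstrict a ha.1 h0.symm hane⟩
      · obtain ⟨k, hk⟩ := exists_nat_gt ((g a - g z₀) / h a)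
        exact ⟨k, by rw [div_lt_iff₀ hpos] at hk; linarith⟩
    have hev : ∀ᶠ y in 𝓝[K \ U] a, g y - k * h y < g z₀ :=
      (((hg.mono sdiff_subset) a ha).sub (hh.continuousWithinAt.const_mul _)).eventually_lt
        continuousWithinAt_const hk
    have hfr := hcl.frequently (eventually_nhdsWithin_iff.mp hev)
    obtain ⟨j, hj, hkj⟩ := (hfr.and_eventually (eventually_ge_atTop k)).exists
    have h1 := hj (hz j)
    have h2 := hzg j
    have h3 : (k : ℝ) * h (z j) ≤ j * h (z j) :=
      mul_le_mul_of_nonneg_right (by exact_mod_cast hkj) (h_nonneg _)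
    linarith
  obtain ⟨k, hk⟩ := key
  obtain ⟨z, hzK, hz⟩ := hK.exists_isMaxOn ⟨z₀, hz₀⟩
    (hg.sub (hh.continuousOn.const_mul (k : ℝ)) : ContinuousOn (fun z => g z - k * h z) K)
  refine ⟨k, z, ⟨hzK, ?_⟩, hz⟩
  by_contra hzU
  have h1 := hk z ⟨hzK, hzU⟩
  have h2 : g z₀ - k * h z₀ ≤ g z - k * h z := hz hz₀
  rw [h₀] at h2
  linarith

theorem exists_generalized_inverse [FiniteDimensional ℝ F] (Λ : E →L[ℝ] F) :
    ∃ R : F →L[ℝ] E, ∀ x, Λ (R (Λ x)) = Λ x := by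
  obtain ⟨R₀, hR₀⟩ := Λ.toLinearMap.rangeRestrict.exists_rightInverse_of_surjective
    (LinearMap.range_rangeRestrict _)
  obtain ⟨R, hR⟩ := R₀.exists_extend
  refine ⟨R.toContinuousLinearMap, fun x => ?_⟩
  have h1 : R (Λ x) = R₀ ⟨Λ x, x, rfl⟩ := LinearMap.congr_fun hR ⟨Λ x, x, rfl⟩
  have h2 := congrArg Subtype.val (LinearMap.congr_fun hR₀ ⟨Λ x, x, rfl⟩)
  simpa [h1] using h2

/-- A function whose value does not change along the direction `d` has zero derivative along `d`. -/
theorem fderiv_apply_eq_zero_of_forall_add_smul {V : Type*} [NormedAddCommGroup V]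
    [NormedSpace ℝ V] {f : V → ℝ} {z d : V} (hf : DifferentiableAt ℝ f z)
    (hd : ∀ r : ℝ, f (z + r • d) = f z) : fderiv ℝ f z d = 0 := by
  have h := hf.hasFDerivAt.hasLineDerivAt d
  have h' : HasLineDerivAt ℝ f 0 z d := by
    simp only [HasLineDerivAt, hd]
    exact hasDerivAt_const _ _
  exact h.unique h'

/-- A test function touching `(t, x) ↦ v (t, Λ x)` from above is stationary along `ker Λ`. -/
theorem fderiv_apply_ker_eq_zero {Λ : E →L[ℝ] F} {v : ℝ × F → ℝ} {φ : ℝ × E → ℝ} {p : ℝ × E}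
    (hφ : DifferentiableAt ℝ φ p)
    (hmax : IsLocalMax (fun q : ℝ × E => v (q.1, Λ q.2) - φ q) p) {x : E} (hx : Λ x = 0) :
    fderiv ℝ φ p (0, x) = 0 := by
  have h := hφ.hasFDerivAt.hasLineDerivAt (0, x)
  refine IsLocalMin.hasDerivAt_eq_zero ?_ h
  have hc : Tendsto (fun r : ℝ => p + r • ((0 : ℝ), x)) (𝓝 0) (𝓝 p) := by
    have : Continuous (fun r : ℝ => p + r • ((0 : ℝ), x)) := by fun_prop
    simpa using this.tendsto 0
  filter_upwards [hc.eventually hmax] with r hr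
  simp [hx] at hr ⊢
  linarith

theorem superdiff_comp_linear [CompleteSpace E] [CompleteSpace F] [FiniteDimensional ℝ F]
    {H : E → ℝ} (hH : Continuous H) (Λ : E →L[ℝ] F) {v : ℝ × F → ℝ}
    (hvc : ContinuousOn v (PiDom F))
    (hv : ∀ p ∈ PiDom F, ∀ sv ∈ superdiff v p,
      sv.1 + H (ContinuousLinearMap.adjoint Λ sv.2) ≤ 0)
    {p : ℝ × E} (hp : p ∈ PiDom E) {sv : ℝ × E}
    (hsv : sv ∈ superdiff (fun p : ℝ × E => v (p.1, Λ p.2)) p) :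
    sv.1 + H sv.2 ≤ 0 := by
  obtain ⟨φ, hφ, hmax, ht, hx⟩ := hsv
  have hmax' : IsLocalMax (fun q : ℝ × E => v (q.1, Λ q.2) - φ q) p :=
    hmax.isLocalMax (isOpen_PiDom.mem_nhds hp)
  obtain ⟨R, hR⟩ := exists_generalized_inverse Λ
  set z₀ : ℝ × F := (p.1, Λ p.2) with hz₀
  set A : ℝ × F → ℝ × E := fun z => (z.1, p.2 + R (z.2 - Λ p.2)) with hA
  have hAz₀ : A z₀ = p := by simp [hA, hz₀]
  have hAsm : ContDiff ℝ 1 A := by fun_prop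
  have hAd : HasFDerivAt A ((ContinuousLinearMap.id ℝ ℝ).prodMap R) z₀ := by
    have h2 := (hasFDerivAt_snd (𝕜 := ℝ) (p := z₀)).sub_const (Λ p.2)
    exact (hasFDerivAt_fst (𝕜 := ℝ) (p := z₀)).prodMk ((R.hasFDerivAt.comp z₀ h2).const_add p.2)
  set Q : F →L[ℝ] F := ContinuousLinearMap.id ℝ F - Λ.comp R with hQ
  have hQΛ : ∀ x, Q (Λ x) = 0 := fun x => by simp [hQ, hR]
  set σ : ℝ × F → ℝ := fun z => (z.1 - p.1) ^ 2 + ‖z.2 - Λ p.2‖ ^ 2 with hσ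
  have hσsm : ContDiff ℝ 1 σ := by
    refine ((contDiff_fst.sub contDiff_const).pow 2).add ?_
    exact (contDiff_snd.sub contDiff_const).norm_sq ℝ
  have hσ0 : fderiv ℝ σ z₀ = 0 := by
    refine IsLocalMin.fderiv_eq_zero (.of_forall fun z => ?_)
    simp only [hσ, hz₀, sub_self, norm_zero, ne_eq, OfNat.ofNat_ne_zero, not_false_eq_true,
      zero_pow, add_zero]
    positivity
  set h : ℝ × F → ℝ := fun z => ‖Q z.2‖ ^ 2 with hh
  have hhsm : ContDiff ℝ 1 h := (Q.contDiff.comp contDiff_snd).norm_sq ℝ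
  have hhd : ∀ (z : ℝ × F) (a : ℝ) (x : E), fderiv ℝ h z (a, Λ x) = 0 := fun z a x =>
    fderiv_apply_eq_zero_of_forall_add_smul (hhsm.differentiable one_ne_zero z)
      fun r => by simp [hh, hQΛ]
  set ψ : ℝ × F → ℝ := fun z => φ (A z) + σ z with hψ
  have hψsm : ContDiff ℝ 1 ψ := (hφ.comp hAsm).add hσsm
  have hψd : ∀ a y, fderiv ℝ ψ z₀ (a, y) = fderiv ℝ φ p (a, R y) := by
    intro a y
    have h1 : HasFDerivAt φ (fderiv ℝ φ p) (A z₀) := by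
      rw [hAz₀]; exact (hφ.differentiable one_ne_zero p).hasFDerivAt
    have h2 := (h1.comp z₀ hAd).add (hσsm.differentiable one_ne_zero z₀).hasFDerivAt
    have h3 : fderiv ℝ ψ z₀ = _ := h2.fderiv
    rw [h3, hσ0]
    simp
  set G : ℝ × F → ℝ := fun z => fderiv ℝ ψ z (1, 0) +
    H ((InnerProductSpace.toDual ℝ E).symm
      ((fderiv ℝ ψ z).comp ((ContinuousLinearMap.inr ℝ ℝ F).comp Λ))) with hG
  have hGc : Continuous G := by
    have hd := hψsm.continuous_fderiv one_ne_zero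
    refine (hd.clm_apply continuous_const).add (hH.comp ?_)
    exact (InnerProductSpace.toDual ℝ E).symm.continuous.comp (hd.clm_comp continuous_const)
  have hG0 : G z₀ = sv.1 + H sv.2 := by
    have h1 : (InnerProductSpace.toDual ℝ E).symm
        ((fderiv ℝ ψ z₀).comp ((ContinuousLinearMap.inr ℝ ℝ F).comp Λ)) = sv.2 := by
      rw [LinearIsometryEquiv.symm_apply_eq]
      ext x
      have h2 : fderiv ℝ φ p (0, R (Λ x) - x) = 0 :=
        fderiv_apply_ker_eq_zero (hφ.differentiable one_ne_zero p) hmax' (by simp [hR])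
      have h3 : ((0 : ℝ), R (Λ x)) = (0, R (Λ x) - x) + (0, x) := by simp
      have h4 : fderiv ℝ φ p (0, R (Λ x)) = ⟪sv.2, x⟫ := by rw [h3, map_add, h2, hx, zero_add]
      simp [hψd, h4]
    simp only [hG, h1, hψd, map_zero, ht]
  rw [← hG0]
  suffices z₀ ∈ closure {z | G z ≤ 0} by
    rwa [(isClosed_le hGc continuous_const).closure_eq] at this
  rw [mem_closure_iff]
  intro U hU hz₀U
  have hz₀Pi : z₀ ∈ PiDom F := ⟨hp.1, mem_univ _⟩
  have hAt : Tendsto A (𝓝 z₀) (𝓝 p) := by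
    simpa only [hAz₀] using hAsm.continuous.tendsto z₀
  obtain ⟨r, hr, hball⟩ := Metric.nhds_basis_closedBall.mem_iff.mp
    ((isOpen_PiDom.eventually_mem hz₀Pi).and (hAt.eventually hmax'))
  obtain ⟨k, z, ⟨-, hzU, hzr⟩, hzmax⟩ := exists_penalized_max
    (isCompact_closedBall z₀ r) (g := fun z => v z - ψ z) (h := h)
    (U := U ∩ Metric.ball z₀ r)
    ((hvc.mono fun z hz => (hball hz).1).sub hψsm.continuous.continuousOn)
    hhsm.continuous (fun z => by positivity) (Metric.mem_closedBall_self hr.le)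
    (by simp [hh, hz₀, hQΛ]) (hU.inter Metric.isOpen_ball) ⟨hz₀U, Metric.mem_ball_self hr⟩
    (by
      intro z hz hz0 hne
      have hQz : Q z.2 = 0 := by simpa [hh] using hz0
      have hz2 : Λ (R z.2) = z.2 := by
        exact (sub_eq_zero.mp (by simpa [hQ] using hQz)).symm
      have h1 := (hball hz).2
      have h2 : 0 < σ z := by
        by_contra! hle
        have ha := sq_nonneg (z.1 - p.1)
        have hb := sq_nonneg ‖z.2 - Λ p.2‖
        simp only [hσ] at hle
        refine hne (Prod.ext ?_ ?_)
        · exact sub_eq_zero.mp (pow_eq_zero_iff two_ne_zero |>.mp (by linarith))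
        · exact sub_eq_zero.mp (norm_eq_zero.mp
            (pow_eq_zero_iff two_ne_zero |>.mp (by linarith)))
      have h3 : v ((A z).1, Λ (A z).2) = v z := by simp [hA, hR, hz2]
      have h4 : σ z₀ = 0 := by simp [hσ, hz₀]
      simp only [h3] at h1
      simp only [hψ, hAz₀, h4]
      linarith)
  refine ⟨z, hzU, ?_⟩
  have hzPi := (hball (Metric.ball_subset_closedBall hzr)).1
  have hΨsm : ContDiff ℝ 1 (fun z => ψ z + k * h z) := hψsm.add (contDiff_const.mul hhsm)
  have hΨd : ∀ a x, fderiv ℝ (fun z => ψ z + k * h z) z (a, Λ x) = fderiv ℝ ψ z (a, Λ x) := by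
    intro a x
    have h1 := hhsm.differentiable one_ne_zero z
    rw [fderiv_fun_add (hψsm.differentiable one_ne_zero z) (h1.const_mul k),
      fderiv_const_mul h1]
    simp [hhd]
  set L := fderiv ℝ (fun z => ψ z + k * h z) z with hL
  have hmem : (L (1, 0), (InnerProductSpace.toDual ℝ F).symm
      (L.comp (ContinuousLinearMap.inr ℝ ℝ F))) ∈ superdiff v z := by
    refine ⟨_, hΨsm, ?_, rfl, fun w => ?_⟩
    · have hloc : IsLocalMax (fun z => v z - ψ z - k * h z) z :=
        hzmax.isLocalMax (Metric.closedBall_mem_nhds_of_mem hzr)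
      simpa only [sub_sub] using hloc.on (PiDom F)
    · simp [hL]
  have hle := hv z hzPi _ hmem
  have hadj : ContinuousLinearMap.adjoint Λ ((InnerProductSpace.toDual ℝ F).symm
      (L.comp (ContinuousLinearMap.inr ℝ ℝ F))) = (InnerProductSpace.toDual ℝ E).symm
      ((fderiv ℝ ψ z).comp ((ContinuousLinearMap.inr ℝ ℝ F).comp Λ)) := by
    rw [LinearIsometryEquiv.eq_symm_apply]
    ext x
    simp [ContinuousLinearMap.adjoint_inner_left, hΨd]
  have ht0 : L (1, 0) = fderiv ℝ ψ z (1, 0) := by simpa using hΨd 1 0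
  rw [hadj, ht0] at hle
  exact hle

/-- **Pullback along an arbitrary linear map** (Proposition 2): if `v` is a viscosity solution
of `v_t + H(Λ*∇_yv) = 0` with data `v₀` on `(0,∞)×ℝᵐ`, then `u(t,x) = v(t,Λx)` is a viscosity
solution of `u_t + H(∇ₓu) = 0` with data `v₀ ∘ Λ` on `(0,∞)×ℝⁿ`. -/
theorem pullback_linear_map {n m : ℕ} (H : EuclideanSpace ℝ (Fin n) → ℝ) (hH : Continuous H)
    (Λ : EuclideanSpace ℝ (Fin n) →L[ℝ] EuclideanSpace ℝ (Fin m))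
    (v₀ : EuclideanSpace ℝ (Fin m) → ℝ) (hv₀ : IsBUC v₀)
    (v : ℝ × EuclideanSpace ℝ (Fin m) → ℝ)
    (hv : IsViscSol (fun w => H (ContinuousLinearMap.adjoint Λ w)) v₀ v) :
    IsViscSol H (fun x => v₀ (Λ x)) (fun p => v (p.1, Λ p.2)) := by
  obtain ⟨⟨hbuc, hini, hsub⟩, -, hini', hsup⟩ := hv
  have hvc : ContinuousOn v (PiDom (EuclideanSpace ℝ (Fin m))) :=
    hbuc.1.mono (prod_mono_left Ioi_subset_Ici_self)
  refine ⟨⟨hbuc.comp_linear Λ, fun x => hini _, fun p hp sv hsv => ?_⟩,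
    hbuc.comp_linear Λ, fun x => hini' _, fun p hp sv hsv => ?_⟩
  · exact superdiff_comp_linear hH Λ hvc hsub hp hsv
  · have hneg : -sv ∈ superdiff (fun q => -v (q.1, Λ q.2)) p :=
      mem_superdiff_neg.mpr (by rwa [neg_neg])
    have h := superdiff_comp_linear (H := fun x => -H (-x)) (by fun_prop) Λ hvc.neg
      (fun q hq rw hrw => by
        have h1 := hsup q hq _ (mem_superdiff_neg.mp hrw)
        simp only [Prod.fst_neg, Prod.snd_neg, map_neg] at h1
        linarith) hp hneg
    simp only [Prod.fst_neg, Prod.snd_neg, neg_neg] at h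
    linarith
end
end

section
/- Density of linear images in the torus: Let λ₁,…,λ_m ∈ ℝⁿ be such that for every nonzero ξ = (ξ₁,…,ξ_m) ∈ ℤᵐ one has ∑_{j=1}^m ξ_j λ_j ≠ 0 (equivalently, λ₁,…,λ_m generate a free abelian group of rank m). Let Λ:ℝⁿ→ℝᵐ be the linear map Λx = (λ₁·x, …, λ_m·x), and let pr:ℝᵐ→𝕋ᵐ=ℝᵐ/ℤᵐ be the natural projection. Then pr(Λ(ℝⁿ)) is dense in 𝕋ᵐ. -/
open Set Filter Topology RealInnerProductSpace

noncomputable section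

open MeasureTheory BoundedContinuousFunction

namespace UnitAddTorus

variable {d : Type*} [Fintype d]

/-- Each Fourier monomial is a character of the torus. -/
theorem mFourier_apply_add (n : d → ℤ) (x y : UnitAddTorus d) :
    mFourier n (x + y) = mFourier n x * mFourier n y := by
  simp [mFourier, fourier_apply, smul_add, AddCircle.toCircle_add, Finset.prod_mul_distrib]

theorem mFourier_apply_coe (n : d → ℤ) (x : d → ℝ) :
    mFourier n (fun j => (x j : UnitAddCircle)) =
      Complex.exp (2 * Real.pi * Complex.I * ((∑ j, (n j : ℝ) * x j : ℝ) : ℂ)) := by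
  simp only [mFourier, ContinuousMap.coe_mk, fourier_coe_apply, ← Complex.exp_sum]
  congr 1
  push_cast
  rw [Finset.mul_sum]
  exact Finset.sum_congr rfl fun j _ => by ring

/-- Finite measures on the torus are determined by their Fourier coefficients. -/
theorem measure_ext_of_integral_mFourier_eq {μ ν : Measure (UnitAddTorus d)}
    [IsFiniteMeasure μ] [IsFiniteMeasure ν]
    (h : ∀ n : d → ℤ, ∫ x, mFourier n x ∂μ = ∫ x, mFourier n x ∂ν) : μ = ν := by
  refine ext_of_forall_mem_subalgebra_integral_eq_of_pseudoEMetric_complete_countable (𝕜 := ℂ)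
    (A := (mFourierSubalgebra d).comap (toContinuousMapStarₐ ℂ)) ?_ ?_
  · intro x y hxy
    obtain ⟨_, ⟨f, hf, rfl⟩, hne⟩ := mFourierSubalgebra_separatesPoints hxy
    exact ⟨f, ⟨f, ⟨mkOfCompact f, hf, rfl⟩, rfl⟩, hne⟩
  · intro g hg
    have hspan : toContinuousMapStarₐ ℂ g ∈ Submodule.span ℂ (range (mFourier (d := d))) := by
      rw [← mFourierSubalgebra_coe]
      exact hg
    have hint (f : C(UnitAddTorus d, ℂ)) (ρ : Measure (UnitAddTorus d)) [IsFiniteMeasure ρ] :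
        Integrable f ρ := (mkOfCompact f).integrable ρ
    change ∫ x, toContinuousMapStarₐ ℂ g x ∂μ = ∫ x, toContinuousMapStarₐ ℂ g x ∂ν
    generalize toContinuousMapStarₐ ℂ g = f at hspan
    induction hspan using Submodule.span_induction with
    | mem f hf =>
      obtain ⟨n, rfl⟩ := hf
      exact h n
    | zero => simp
    | add f₁ f₂ _ _ h₁ h₂ =>
      simp only [ContinuousMap.add_apply]
      rw [integral_add (hint f₁ μ) (hint f₂ μ), integral_add (hint f₁ ν) (hint f₂ ν), h₁, h₂]
    | smul c f _ hf =>
      simp only [ContinuousMap.smul_apply, integral_smul, hf]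

theorem integral_mFourier_eq_zero {G : Type*} [AddGroup G] [MeasurableSpace G] [MeasurableAdd G]
    (μ : Measure G) [μ.IsAddLeftInvariant] (φ : G →+ UnitAddTorus d) {n : d → ℤ} {h : G}
    (hn : mFourier n (φ h) ≠ 1) : ∫ x, mFourier n (φ x) ∂μ = 0 := by
  have key := integral_add_left_eq_self (μ := μ) (fun x => mFourier n (φ x)) h
  simp only [map_add, mFourier_apply_add, integral_const_mul] at key
  exact (mul_left_eq_self₀.mp key).resolve_left hn

/-- A closed subgroup of the torus on which every nontrivial character is nontrivial is the whole
torus. -/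
theorem closed_addSubgroup_eq_top {H : AddSubgroup (UnitAddTorus d)}
    (hH : IsClosed (H : Set (UnitAddTorus d)))
    (hchar : ∀ n : d → ℤ, n ≠ 0 → ∃ x ∈ H, mFourier n x ≠ 1) : H = ⊤ := by
  have : CompactSpace H := isCompact_iff_compactSpace.mp hH.isCompact
  let μ : Measure H := Measure.addHaarMeasure ⊤
  have : IsProbabilityMeasure μ := ⟨Measure.addHaarMeasure_self⟩
  have hmeas : Measurable H.subtype := measurable_subtype_coe
  have : IsProbabilityMeasure (μ.map H.subtype) :=
    Measure.isProbabilityMeasure_map hmeas.aemeasurable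
  have hμ : μ.map H.subtype = volume := by
    refine measure_ext_of_integral_mFourier_eq fun n => ?_
    rw [integral_map hmeas.aemeasurable (mFourier n).continuous.aestronglyMeasurable]
    rcases eq_or_ne n 0 with rfl | hn
    · simp [mFourier_zero, Measure.real, volume_pi, Measure.pi_univ]
    · obtain ⟨x, hx, hne⟩ := hchar n hn
      rw [integral_mFourier_eq_zero μ H.subtype (h := ⟨x, hx⟩) hne]
      exact (integral_mFourier_eq_zero volume (AddMonoidHom.id _) hne).symm
  have hnull : volume (H : Set (UnitAddTorus d))ᶜ = 0 := by
    rw [← hμ, Measure.map_apply hmeas hH.measurableSet.compl]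
    convert measure_empty (μ := μ)
    ext x
    simp
  have hempty := (hH.isOpen_compl.measure_eq_zero_iff volume).mp hnull
  exact SetLike.coe_injective (compl_empty_iff.mp hempty)

end UnitAddTorus

/-- **Density of linear images in the torus**: if `λ₁,…,λ_m ∈ ℝⁿ` generate a free abelian group
of rank `m` (no nonzero integer vector `ξ` satisfies `∑ ξ_jλ_j = 0`), then the image in
`𝕋ᵐ = ℝᵐ/ℤᵐ` of the range of `Λx = (λ₁·x,…,λ_m·x)` is dense. -/
theorem dense_linear_image_in_torus {n m : ℕ} (lam : Fin m → EuclideanSpace ℝ (Fin n))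
    (hfree : ∀ ξ : Fin m → ℤ, ξ ≠ 0 → ∑ j, (ξ j : ℝ) • lam j ≠ 0) :
    Dense (Set.range fun x : EuclideanSpace ℝ (Fin n) =>
      fun j : Fin m => ((⟪lam j, x⟫ : ℝ) : AddCircle (1 : ℝ))) := by
  let φ : EuclideanSpace ℝ (Fin n) →+ UnitAddTorus (Fin m) :=
    AddMonoidHom.mk' (fun x j => ((⟪lam j, x⟫ : ℝ) : AddCircle (1 : ℝ))) fun x y => by
      ext j
      simp [inner_add_right]
  have htop : φ.range.topologicalClosure = ⊤ := by
    refine UnitAddTorus.closed_addSubgroup_eq_top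
      φ.range.isClosed_topologicalClosure fun ξ hξ => ?_
    set v := ∑ j, (ξ j : ℝ) • lam j with hv
    have hinner : ⟪v, v⟫ ≠ 0 := inner_self_ne_zero.mpr (hfree ξ hξ)
    refine ⟨φ ((2 * ⟪v, v⟫)⁻¹ • v), φ.range.le_topologicalClosure ⟨_, rfl⟩, ?_⟩
    have hsum : ∑ j, (ξ j : ℝ) * ⟪lam j, (2 * ⟪v, v⟫)⁻¹ • v⟫ = 1 / 2 := by
      calc ∑ j, (ξ j : ℝ) * ⟪lam j, (2 * ⟪v, v⟫)⁻¹ • v⟫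
          = ⟪v, (2 * ⟪v, v⟫)⁻¹ • v⟫ := by
            conv_rhs => rw [hv, sum_inner]
            simp only [real_inner_smul_left, ← hv]
        _ = 1 / 2 := by
            rw [real_inner_smul_right]
            field_simp
    change UnitAddTorus.mFourier ξ (fun j => ((⟪lam j, _⟫ : ℝ) : UnitAddCircle)) ≠ 1
    rw [UnitAddTorus.mFourier_apply_coe, hsum]
    have hexp : 2 * Real.pi * Complex.I * ((1 / 2 : ℝ) : ℂ) = Real.pi * Complex.I := by
      push_cast
      ring
    rw [hexp, Complex.exp_pi_mul_I]
    norm_num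
  rw [dense_iff_closure_eq]
  exact congrArg SetLike.coe htop
end
end
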